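/- For every tree t, dim(t) = rank(β(t)), where β is the flattening of t. -/

import Mathlib

/-- The two-letter Dyck alphabet: `D.ab` is `ā` (the opening symbol) and `D.a` is `a`
(the closing symbol). -/
inductive D where
  | ab : D  -- ā
  | a : D   -- a
deriving DecidableEq

/-- Parse trees of the grammar `G_D = ({S}, {ā, a}, S, {S → ā S a S, S → ε})`:
`eps` is an application of `S → ε` and `node t₁ t₂` an application of `S → ā S a S`. -/
inductive DyckTree where
  | eps : DyckTree
  | node : DyckTree → DyckTree → DyckTree

/-- The word generated by a parse tree of `G_D`. -/
def DyckTree.yield : DyckTree → List D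
  | .eps => []
  | .node t₁ t₂ => D.ab :: (t₁.yield ++ D.a :: t₂.yield)

/-- The Dyck language `L_D`: the language generated by `G_D`. -/
def LD : Set (List D) := { w | ∃ t : DyckTree, t.yield = w }

/-- `Matches t i j` holds iff positions `i < j` (0-indexed) of the word `t.yield` form a
matching pair: position `i` carries `ā`, position `j` carries `a`, and the two
corresponding leaves have the same parent in the parse tree `t`. -/
inductive Matches : DyckTree → ℕ → ℕ → Prop
  | head (t₁ t₂ : DyckTree) : Matches (.node t₁ t₂) 0 (t₁.yield.length + 1)
  | left {t₁ : DyckTree} {i j : ℕ} (t₂ : DyckTree) :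
      Matches t₁ i j → Matches (.node t₁ t₂) (i + 1) (j + 1)
  | right {t₂ : DyckTree} {i j : ℕ} (t₁ : DyckTree) :
      Matches t₂ i j → Matches (.node t₁ t₂) (t₁.yield.length + 2 + i) (t₁.yield.length + 2 + j)

/-- `DelStep w v`: `v` results from `w ∈ L_D` by deleting (both positions of) one
matching pair of `w`. -/
def DelStep (w v : List D) : Prop :=
  ∃ (t : DyckTree) (i j : ℕ), t.yield = w ∧ Matches t i j ∧
    v = (w.eraseIdx j).eraseIdx i

/-- The ordering `≼` on Dyck words: `dyckLE v w` (i.e. `v ≼ w`) holds iff `v` results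
from `w` by deleting 0 or more matching pairs. -/
def dyckLE (v w : List D) : Prop := Relation.ReflTransGen DelStep w v

/-- The harmonics: `h_0 = ε` and `h_{i+1} = ā h_i a ā h_i a`. -/
def harmonicW : ℕ → List D
  | 0 => []
  | i + 1 => (D.ab :: (harmonicW i ++ [D.a])) ++ (D.ab :: (harmonicW i ++ [D.a]))

/-- `ĥ_i = ā h_i a`. -/
def hatHarmonic (i : ℕ) : List D := D.ab :: (harmonicW i ++ [D.a])

/-- The rank of a Dyck word `w`: the greatest `q` such that `h_q ≼ w`. -/
noncomputable def rank (w : List D) : ℕ := sSup { q : ℕ | dyckLE (harmonicW q) w }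

/-!
STATEMENT 8: For every tree `t`, `dim(t) = rank(β(t))`, where `β` is the flattening
of `t`.
-/

/-- Finitely-branching ordered trees (the flattening and the dimension depend only on
the shape of a tree); a leaf is a node with no children. -/
inductive GT where
  | node : List GT → GT

/-- The flattening `β`: `β(n) = ε` for a leaf `n`, and
`β(n) = ā β(n₁) a ā β(n₂) a … ā β(n_k) a` if `n` has children `n₁, …, n_k` in order;
`β(t) = β(n)` where `n` is the root of `t`. -/
def betaG : GT → List D
  | .node ts => (ts.attach.map (fun t => D.ab :: (betaG t.1 ++ [D.a]))).flatten
decreasing_by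
  simp only [GT.node.sizeOf_spec]
  have := List.sizeOf_lt_of_mem t.2
  omega

/-- The dimension: a leaf has dimension 0; a node with children `n₁, …, n_k` (`k ≥ 1`)
has dimension `max_i dim(n_i)` if this maximum is attained by a unique child, and
`max_i dim(n_i) + 1` otherwise. -/
def dimG : GT → ℕ
  | .node ts =>
      let ds := ts.attach.map (fun t => dimG t.1)
      if ds = [] then 0
      else if ds.count (ds.foldr max 0) = 1 then ds.foldr max 0 else ds.foldr max 0 + 1
decreasing_by
  simp only [GT.node.sizeOf_spec]
  have := List.sizeOf_lt_of_mem t.2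
  omega

namespace DyckTree

/-- Concatenation of parse trees; it yields the concatenation of the words. -/
def app : DyckTree → DyckTree → DyckTree
  | eps, b => b
  | node a₁ a₂, b => node a₁ (a₂.app b)

theorem yield_app (a b : DyckTree) : (a.app b).yield = a.yield ++ b.yield := by
  induction a with
  | eps => rfl
  | node a₁ a₂ _ ih => simp [app, yield, ih]

theorem app_eps (a : DyckTree) : a.app eps = a := by
  induction a with
  | eps => rfl
  | node a₁ a₂ _ ih => simp [app, ih]

theorem eq_of_yield_append_eq (s t : DyckTree) : ∀ u v : List D,
    u.head? ≠ some D.ab → v.head? ≠ some D.ab →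
    s.yield ++ u = t.yield ++ v → s = t ∧ u = v := by
  induction s generalizing t with
  | eps =>
    intro u v hu _ h
    cases t with
    | eps => exact ⟨rfl, h⟩
    | node t₁ t₂ =>
      simp only [yield, List.nil_append] at h
      simp [h] at hu
  | node s₁ s₂ ih₁ ih₂ =>
    intro u v hu hv h
    cases t with
    | eps =>
      simp only [yield, List.nil_append] at h
      simp [← h] at hv
    | node t₁ t₂ =>
      simp only [yield, List.cons_append, List.append_assoc, List.cons.injEq, true_and] at h
      obtain ⟨rfl, h'⟩ := ih₁ t₁ _ _ (by simp) (by simp) h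
      obtain ⟨rfl, h''⟩ := ih₂ t₂ u v hu hv (List.cons.inj h').2
      exact ⟨rfl, h''⟩

theorem yield_injective : Function.Injective yield := fun s t h =>
  (eq_of_yield_append_eq s t [] [] (by simp) (by simp) (by simpa using h)).1

/-- `Del s t`: the parse tree `t` results from `s` by deleting one matching pair. -/
inductive Del : DyckTree → DyckTree → Prop
  | head (a b : DyckTree) : Del (node a b) (a.app b)
  | left {a a' : DyckTree} (b : DyckTree) : Del a a' → Del (node a b) (node a' b)
  | right (a : DyckTree) {b b' : DyckTree} : Del b b' → Del (node a b) (node a b')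

end DyckTree

theorem Matches.lt {t : DyckTree} {i j : ℕ} (h : Matches t i j) :
    i < j ∧ j < t.yield.length := by
  induction h with
  | head => simp [DyckTree.yield]
  | left => simp [DyckTree.yield]; omega
  | right => simp [DyckTree.yield]; omega

namespace DyckTree

theorem eraseIdx_head (a b : DyckTree) :
    ((node a b).yield.eraseIdx (a.yield.length + 1)).eraseIdx 0 = (a.app b).yield := by
  simp [yield, yield_app, List.eraseIdx_append_of_length_le]

theorem eraseIdx_left {a : DyckTree} (b : DyckTree) {i j : ℕ} (h : Matches a i j) :
    ((node a b).yield.eraseIdx (j + 1)).eraseIdx (i + 1) =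
      D.ab :: ((a.yield.eraseIdx j).eraseIdx i ++ D.a :: b.yield) := by
  have := h.lt
  have hl : i < (a.yield.eraseIdx j).length := by
    rw [List.length_eraseIdx_of_lt this.2]; omega
  simp [yield, List.eraseIdx_append_of_lt_length this.2,
    List.eraseIdx_append_of_lt_length hl]

theorem eraseIdx_right (a : DyckTree) {b : DyckTree} (i j : ℕ) :
    ((node a b).yield.eraseIdx (a.yield.length + 2 + j)).eraseIdx (a.yield.length + 2 + i) =
      D.ab :: (a.yield ++ D.a :: (b.yield.eraseIdx j).eraseIdx i) := by
  have e (l r : List D) (k : ℕ) : (D.ab :: (l ++ D.a :: r)).eraseIdx (l.length + 2 + k) =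
      D.ab :: (l ++ D.a :: r.eraseIdx k) := by
    have h := List.eraseIdx_append_of_length_le (l := D.ab :: (l ++ [D.a]))
      (k := l.length + 2 + k) (by simp) r
    have hk : l.length + 2 + k - (l.length + 1 + 1) = k := by omega
    simpa [hk] using h
  rw [yield, e, e]

theorem Matches.exists_del {t : DyckTree} {i j : ℕ} (h : Matches t i j) :
    ∃ t', Del t t' ∧ t'.yield = (t.yield.eraseIdx j).eraseIdx i := by
  induction h with
  | head a b => exact ⟨_, .head a b, (eraseIdx_head a b).symm⟩
  | left b h ih =>
    obtain ⟨a', hd, hy⟩ := ih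
    exact ⟨_, .left b hd, by rw [eraseIdx_left b h, yield, hy]⟩
  | right a h ih =>
    obtain ⟨b', hd, hy⟩ := ih
    exact ⟨_, .right a hd, by rw [eraseIdx_right, yield, hy]⟩

theorem Del.exists_matches {t t' : DyckTree} (h : Del t t') :
    ∃ i j, Matches t i j ∧ t'.yield = (t.yield.eraseIdx j).eraseIdx i := by
  induction h with
  | head a b => exact ⟨_, _, .head a b, (eraseIdx_head a b).symm⟩
  | left b h ih =>
    obtain ⟨i, j, hm, hy⟩ := ih
    exact ⟨_, _, .left b hm, by rw [eraseIdx_left b hm, yield, hy]⟩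
  | right a h ih =>
    obtain ⟨i, j, hm, hy⟩ := ih
    exact ⟨_, _, .right a hm, by rw [eraseIdx_right, yield, hy]⟩

theorem dyckLE_yield_iff (v : List D) (t : DyckTree) :
    dyckLE v t.yield ↔ ∃ t', Relation.ReflTransGen Del t t' ∧ t'.yield = v := by
  constructor
  · intro h
    induction h with
    | refl => exact ⟨t, .refl, rfl⟩
    | tail _ hs ih =>
      obtain ⟨s, hts, rfl⟩ := ih
      obtain ⟨s', i, j, hy, hm, rfl⟩ := hs
      obtain rfl := yield_injective hy
      obtain ⟨t', hd, hy'⟩ := Matches.exists_del hm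
      exact ⟨t', hts.tail hd, hy'⟩
  · rintro ⟨t', h, rfl⟩
    refine h.lift yield fun s s' hd => ?_
    obtain ⟨i, j, hm, hy⟩ := hd.exists_matches
    exact ⟨s, i, j, rfl, hm, hy⟩

mutual

/-- The dimension of the forest encoded by a parse tree: the dimension of the tree obtained by
attaching a common root to its components. -/
def dim : DyckTree → ℕ
  | eps => 0
  | node a b => if b.height = a.dim + 1 then a.dim + 1 else max a.dim b.dim

/-- One more than the maximal dimension of a component of the forest encoded by a parse tree,
and `0` for the empty forest. -/
def height : DyckTree → ℕ
  | eps => 0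
  | node a b => max (a.dim + 1) b.height

end

theorem dim_le_height_le (t : DyckTree) : t.dim ≤ t.height ∧ t.height ≤ t.dim + 1 := by
  induction t with
  | eps => simp [dim, height]
  | node a b iha ihb => rw [dim, height]; split <;> omega

theorem height_app (a b : DyckTree) : (a.app b).height = max a.height b.height := by
  induction a with
  | eps => simp [app, height]
  | node a₁ a₂ _ ih => rw [app, height, ih, height, max_assoc]

theorem dim_app (a b : DyckTree) : (a.app b).dim =
    if a.height = b.height then a.height else max a.dim b.dim := by
  induction a with
  | eps =>
    have := dim_le_height_le b
    rw [app, height, dim]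
    split_ifs <;> omega
  | node a₁ a₂ _ ih =>
    have h₂ := dim_le_height_le a₂
    have h₃ := dim_le_height_le b
    rw [app, dim, ih, height_app, height, dim]
    split_ifs <;> omega

theorem Del.le {t t' : DyckTree} (h : Del t t') : t'.dim ≤ t.dim ∧ t'.height ≤ t.height := by
  induction h with
  | head a b =>
    have ha := dim_le_height_le a
    have hb := dim_le_height_le b
    rw [dim_app, height_app, dim, height]
    split_ifs <;> omega
  | @left a a' b _ ih =>
    have hb := dim_le_height_le b
    rw [dim, height, dim, height]
    split_ifs <;> omega
  | @right a b b' _ ih =>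
    have hb := dim_le_height_le b
    have hb' := dim_le_height_le b'
    rw [dim, height, dim, height]
    split_ifs <;> omega

theorem dim_le_of_reflTransGen {t t' : DyckTree} (h : Relation.ReflTransGen Del t t') :
    t'.dim ≤ t.dim := by
  induction h with
  | refl => exact le_rfl
  | tail _ hd ih => exact hd.le.1.trans ih

/-- The parse tree of the harmonic `h_q`. -/
def harmonic : ℕ → DyckTree
  | 0 => eps
  | q + 1 => node (harmonic q) (node (harmonic q) eps)

theorem yield_harmonic (q : ℕ) : (harmonic q).yield = harmonicW q := by
  induction q with
  | zero => rfl
  | succ q ih => simp [harmonic, harmonicW, yield, ih]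

theorem dim_harmonic (q : ℕ) : (harmonic q).dim = q := by
  induction q with
  | zero => simp [harmonic, dim]
  | succ q ih => simp [harmonic, dim, height, ih]

theorem reflTransGen_left {a a' : DyckTree} (b : DyckTree)
    (h : Relation.ReflTransGen Del a a') :
    Relation.ReflTransGen Del (node a b) (node a' b) :=
  h.lift (fun x => node x b) fun _ _ => .left b

theorem reflTransGen_right (a : DyckTree) {b b' : DyckTree}
    (h : Relation.ReflTransGen Del b b') :
    Relation.ReflTransGen Del (node a b) (node a b') :=
  h.lift (node a) fun _ _ => .right a

theorem reflTransGen_eps (t : DyckTree) : Relation.ReflTransGen Del t eps := by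
  induction t with
  | eps => exact .refl
  | node a b iha ihb =>
    exact ((reflTransGen_left b iha).tail (.head eps b)).trans ihb

theorem reflTransGen_node_right (a b : DyckTree) : Relation.ReflTransGen Del (node a b) b :=
  (reflTransGen_left b (reflTransGen_eps a)).tail (.head eps b)

theorem reflTransGen_node_left (a b : DyckTree) : Relation.ReflTransGen Del (node a b) a := by
  simpa only [app_eps] using (reflTransGen_right a (reflTransGen_eps b)).tail (.head a eps)

theorem reflTransGen_harmonic (t : DyckTree) :
    Relation.ReflTransGen Del t (harmonic t.dim) ∧
      ∀ m, t.height = m + 1 → Relation.ReflTransGen Del t (node (harmonic m) eps) := by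
  induction t with
  | eps => exact ⟨by simpa only [dim] using .refl, by simp [height]⟩
  | node a b iha ihb =>
    constructor
    · rw [dim]
      split_ifs with h
      · exact (reflTransGen_left b iha.1).trans (reflTransGen_right _ (ihb.2 _ h))
      · rcases max_choice a.dim b.dim with hm | hm <;> rw [hm]
        · exact (reflTransGen_node_left a b).trans iha.1
        · exact (reflTransGen_node_right a b).trans ihb.1
    · intro m hm
      rw [height] at hm
      rcases max_choice (a.dim + 1) b.height with h | h
      · obtain rfl : a.dim = m := by omega
        exact (reflTransGen_left b iha.1).trans (reflTransGen_right _ (reflTransGen_eps b))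
      · exact (reflTransGen_node_right a b).trans (ihb.2 m (h ▸ hm))

theorem rank_yield (t : DyckTree) : rank t.yield = t.dim := by
  refine IsGreatest.csSup_eq ⟨?_, ?_⟩
  · exact (dyckLE_yield_iff _ t).2 ⟨_, (reflTransGen_harmonic t).1, yield_harmonic _⟩
  · intro q hq
    obtain ⟨t', ht, hy⟩ := (dyckLE_yield_iff _ t).1 hq
    obtain rfl : t' = harmonic q := yield_injective (hy.trans (yield_harmonic q).symm)
    simpa only [dim_harmonic] using dim_le_of_reflTransGen ht

end DyckTree

/-- The dimension of a node as a function of the list of dimensions of its children. -/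
def dimOfChildren (ds : List ℕ) : ℕ :=
  if ds = [] then 0
  else if ds.count (ds.foldr max 0) = 1 then ds.foldr max 0 else ds.foldr max 0 + 1

theorem dimG_node (ts : List GT) : dimG (.node ts) = dimOfChildren (ts.map dimG) := by
  rw [dimG]
  simp only [List.map_attach_eq_pmap, List.pmap_eq_map, dimOfChildren]

theorem betaG_node (ts : List GT) :
    betaG (.node ts) = (ts.map fun t => D.ab :: (betaG t ++ [D.a])).flatten := by
  rw [betaG]
  simp only [List.map_attach_eq_pmap, List.pmap_eq_map]

theorem le_foldr_max {x : ℕ} {ds : List ℕ} (h : x ∈ ds) : x ≤ ds.foldr max 0 := by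
  induction ds with
  | nil => simp at h
  | cons d ds ih => rcases List.mem_cons.1 h with rfl | h <;> simp_all

theorem foldr_max_mem {ds : List ℕ} (h : ds ≠ []) : ds.foldr max 0 ∈ ds := by
  induction ds with
  | nil => exact absurd rfl h
  | cons d ds ih =>
    rw [List.foldr_cons]
    rcases max_choice d (ds.foldr max 0) with hm | hm <;> rw [hm]
    · exact List.mem_cons_self
    · cases ds with
      | nil => simp at hm ⊢; omega
      | cons e es => exact List.mem_cons_of_mem _ (ih (by simp))

theorem dimOfChildren_cons (x : ℕ) {ds : List ℕ} (h : ds ≠ []) :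
    dimOfChildren (x :: ds) =
      if ds.foldr max 0 = x then x + 1 else max x (dimOfChildren ds) := by
  have hpos := List.count_pos_iff.2 (foldr_max_mem h)
  rw [dimOfChildren, dimOfChildren, if_neg (List.cons_ne_nil x ds), if_neg h, List.foldr_cons]
  rcases lt_trichotomy x (ds.foldr max 0) with hx | hx | hx
  · rw [max_eq_right hx.le, List.count_cons_of_ne hx.ne]
    split_ifs <;> omega
  · rw [← hx] at hpos ⊢
    rw [max_self, List.count_cons_self, if_neg (by omega), if_pos rfl]
  · have h0 : ds.count x = 0 := List.count_eq_zero.2 fun hm => by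
      have := le_foldr_max hm
      omega
    rw [max_eq_left hx.le, List.count_cons_self, h0, if_pos rfl]
    split_ifs <;> omega

theorem exists_forest_tree (ts : List GT)
    (h : ∀ t ∈ ts, ∃ d : DyckTree, d.yield = betaG t ∧ d.dim = dimG t) :
    ∃ d : DyckTree, d.yield = betaG (.node ts) ∧ d.dim = dimG (.node ts) ∧
      d.height = if ts = [] then 0 else (ts.map dimG).foldr max 0 + 1 := by
  induction ts with
  | nil => exact ⟨.eps, by simp [betaG_node, DyckTree.yield],
      by simp [dimG_node, dimOfChildren, DyckTree.dim], by simp [DyckTree.height]⟩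
  | cons t ts ih =>
    obtain ⟨d, hy, hd⟩ := h t List.mem_cons_self
    obtain ⟨e, ey, ed, eh⟩ := ih fun s hs => h s (List.mem_cons_of_mem _ hs)
    refine ⟨.node d e, ?_, ?_, ?_⟩
    · rw [betaG_node] at ey ⊢
      simp [DyckTree.yield, hy, ey]
    · rw [dimG_node] at ed ⊢
      rw [DyckTree.dim, hd, ed, eh, List.map_cons]
      by_cases hts : ts = []
      · simp [hts, dimOfChildren]
      · rw [dimOfChildren_cons _ (by simpa using hts), if_neg hts]
        simp only [Nat.add_right_cancel_iff]
    · rw [DyckTree.height, hd, eh]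
      by_cases hts : ts = [] <;> simp [hts]

theorem exists_tree_yield_eq_betaG :
    ∀ t : GT, ∃ d : DyckTree, d.yield = betaG t ∧ d.dim = dimG t
  | .node ts => by
    obtain ⟨d, hy, hd, _⟩ := exists_forest_tree ts fun t _ => exists_tree_yield_eq_betaG t
    exact ⟨d, hy, hd⟩

theorem dim_eq_rank_flattening : ∀ t : GT, dimG t = rank (betaG t) := by
  intro t
  obtain ⟨d, hy, hd⟩ := exists_tree_yield_eq_betaG t
  rw [← hy, ← hd, DyckTree.rank_yield]
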